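/- Let γ̄ > 0, κ > 0 and let μ, m be positive integers with m < μ. Set Δ₁ = γ̄/(μ(1+κ)) and Δ₂ = ((μκ+m)/m)·γ̄/(μ(1+κ)), and let A₁ⱼ = (−1)^m · C(m+j−2, j−1) · (m/(μκ+m))^m · (μκ/(μκ+m))^{−(m+j−1)} and A₂ⱼ = (−1)^{j−1} · C(μ−m+j−2, j−1) · (m/(μκ+m))^{j−1} · (μκ/(μκ+m))^{m−μ−j+1}. Then the average channel capacity in κ-μ shadowed fading satisfies ∫₀^∞ log₂(1+x) f_S(x) dx = log₂(e) · [ Σ_{j=1}^{μ−m} A₁ⱼ · e^{1/Δ₁} · Σ_{k=0}^{μ−m−j} Δ₁^{−k} Γ(−k, 1/Δ₁) + Σ_{j=1}^{m} A₂ⱼ · e^{1/Δ₂} · Σ_{k=0}^{m−j} Δ₂^{−k} Γ(−k, 1/Δ₂) ], where Γ(−k, z) = ∫_z^∞ t^{−k−1} e^{−t} dt is the upper incomplete gamma function. -/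

import Mathlib

open Real MeasureTheory Finset

/-- Rising factorial (Pochhammer symbol) `(a)ₙ = a(a+1)⋯(a+n−1)`. -/
noncomputable def risingFactorial (a : ℝ) (n : ℕ) : ℝ := ∏ i ∈ Finset.range n, (a + i)

/-- Confluent hypergeometric function `₁F₁(a; b; z) = Σ (a)ₙ/(b)ₙ zⁿ/n!`. -/
noncomputable def hyp1F1 (a b z : ℝ) : ℝ :=
  ∑' n : ℕ, risingFactorial a n / risingFactorial b n * z ^ n / (Nat.factorial n : ℝ)

/-- The κ-μ shadowed density with integer fading parameters μ, m. -/
noncomputable def kmuShadowedPDF (γ κ : ℝ) (μ m : ℕ) (x : ℝ) : ℝ :=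
  ((μ : ℝ) ^ μ * (m : ℝ) ^ m * (1 + κ) ^ μ) /
      ((Nat.factorial (μ - 1) : ℝ) * ((m : ℝ) + μ * κ) ^ m * γ) *
    (x / γ) ^ (μ - 1) * Real.exp (-(μ * (1 + κ) * x / γ)) *
    hyp1F1 m μ ((μ : ℝ) ^ 2 * κ * (1 + κ) * x / (((μ : ℝ) * κ + m) * γ))

/-- Upper incomplete gamma function `Γ(−k, z) = ∫_z^∞ t^{−k−1} e^{−t} dt` at negative
integer first argument. -/
noncomputable def upperGammaNegInt (k : ℕ) (z : ℝ) : ℝ :=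
  ∫ t in Set.Ioi z, t ^ (-(k : ℤ) - 1) * Real.exp (-t)

/-! ### Partial fractions for the confluent hypergeometric series -/

lemma hasSum_of_eq {f g : ℕ → ℝ} {s t : ℝ} (h : HasSum f s) (hfg : ∀ k, g k = f k)
    (hst : t = s) : HasSum g t := by
  rwa [hst, funext hfg]

lemma cast_multichoose_succ_succ (m k : ℕ) :
    (Nat.multichoose (m + 1) (k + 1) : ℝ) =
      Nat.multichoose m (k + 1) + Nat.multichoose (m + 1) k := by
  rw [Nat.multichoose_succ_succ]; push_cast; rfl

/-- Contiguity relation in the parameters for the shifted hypergeometric series. -/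
lemma hasSum_multichoose_contiguous {p q y s t : ℝ} (hq : q ≠ 0) (n m : ℕ)
    (hs : HasSum (fun k : ℕ => p ^ (m + 1) * Nat.multichoose (m + 1) k * q ^ k *
      (y ^ (n + m + k) / (Nat.factorial (n + m + k) : ℝ))) s)
    (ht : HasSum (fun k : ℕ => p ^ m * Nat.multichoose m k * q ^ k *
      (y ^ (n + m + k) / (Nat.factorial (n + m + k) : ℝ))) t) :
    HasSum (fun k : ℕ => p ^ (m + 1) * Nat.multichoose (m + 1) k * q ^ k *
      (y ^ (n + m + 1 + k) / (Nat.factorial (n + m + 1 + k) : ℝ))) (q⁻¹ * (s - p * t)) := by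
  have h := hs.sub (ht.mul_left p)
  rw [← hasSum_nat_add_iff' 1] at h
  have h' := h.mul_left q⁻¹
  refine hasSum_of_eq h' (fun k => ?_) ?_
  · rw [cast_multichoose_succ_succ, show n + m + (k + 1) = n + m + 1 + k by ring, pow_succ q k]
    field_simp
    ring
  · simp [pow_succ]
    ring_nf
    simp

/-- Recurrence for the coefficients belonging to the first pole. -/
lemma sum_multichoose_first_pole (p q : ℝ) (n m : ℕ) (e : ℕ → ℝ) :
    ∑ i ∈ range (n + 1), (-1) ^ (m + 1) * Nat.multichoose (m + 1) i * p ^ (m + 1) *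
        q⁻¹ ^ (m + 1 + i) * e (n - i) =
      q⁻¹ * (∑ i ∈ range n, (-1) ^ (m + 1) * Nat.multichoose (m + 1) i * p ^ (m + 1) *
        q⁻¹ ^ (m + 1 + i) * e (n - 1 - i) -
      p * ∑ i ∈ range (n + 1), (-1) ^ m * Nat.multichoose m i * p ^ m *
        q⁻¹ ^ (m + i) * e (n - i)) := by
  rw [sum_range_succ', sum_range_succ' _ n, mul_sub, mul_add, mul_add, mul_sum, mul_sum, mul_sum,
    sub_add_eq_sub_sub, ← sum_sub_distrib, sub_eq_add_neg]
  congr 1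
  · refine sum_congr rfl fun i _ => ?_
    rw [cast_multichoose_succ_succ, show n - (i + 1) = n - 1 - i by omega]
    ring
  · simp
    ring

/-- Recurrence for the coefficients belonging to the second pole. -/
lemma sum_multichoose_second_pole (p q : ℝ) (n m : ℕ) (e : ℕ → ℝ) :
    ∑ i ∈ range (m + 1), (-1) ^ i * Nat.multichoose (n + 1) i * p ^ i *
        q⁻¹ ^ (n + 1 + i) * e (m - i) =
      q⁻¹ * (∑ i ∈ range (m + 1), (-1) ^ i * Nat.multichoose n i * p ^ i *
        q⁻¹ ^ (n + i) * e (m - i) -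
      p * ∑ i ∈ range m, (-1) ^ i * Nat.multichoose (n + 1) i * p ^ i *
        q⁻¹ ^ (n + 1 + i) * e (m - 1 - i)) := by
  rw [sum_range_succ', sum_range_succ' _ m, mul_sub, mul_add, mul_sum, mul_sum, mul_sum,
    add_sub_right_comm, ← sum_sub_distrib]
  congr 1
  · refine sum_congr rfl fun i _ => ?_
    rw [cast_multichoose_succ_succ, show m - (i + 1) = m - 1 - i by omega]
    ring
  · simp
    ring

lemma hasSum_exp_mul_pow_div_factorial (q y : ℝ) (m : ℕ) :
    HasSum (fun k : ℕ => (Nat.multichoose (m + 1) k : ℝ) * q ^ k *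
      (y ^ (m + k) / (Nat.factorial (m + k) : ℝ)))
      (Real.exp (q * y) * (y ^ m / (Nat.factorial m : ℝ))) := by
  have h := NormedSpace.expSeries_div_hasSum_exp (q * y)
  rw [← Real.exp_eq_exp_ℝ] at h
  refine hasSum_of_eq (h.mul_right (y ^ m / (Nat.factorial m : ℝ))) (fun k => ?_) rfl
  have hf : (Nat.factorial (m + k) : ℝ) =
      Nat.factorial m * (Nat.factorial k * Nat.multichoose (m + 1) k) := by
    rw [Nat.multichoose_eq, show m + 1 + k - 1 = m + k by omega, ← Nat.factorial_mul_ascFactorial,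
      Nat.ascFactorial_eq_factorial_mul_choose]
    push_cast
    rfl
  have h0 : (Nat.factorial (m + k) : ℝ) ≠ 0 := by positivity
  have h1 : (Nat.factorial k : ℝ) ≠ 0 := by positivity
  have h2 : (Nat.factorial m : ℝ) ≠ 0 := by positivity
  rw [hf] at h0 ⊢
  have h3 : (Nat.multichoose (m + 1) k : ℝ) ≠ 0 := by
    intro h3; simp [h3] at h0
  field_simp
  ring

/-- Partial fraction expansion of the shifted confluent hypergeometric series: the time-domain
form of `(1 + sΔ₁)⁻ⁿ (1 + sΔ₂)⁻ᵐ`. -/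
lemma hasSum_partial_fractions {p q : ℝ} (hq : q ≠ 0) (y : ℝ) (n m : ℕ) (hnm : 0 < n + m) :
    HasSum (fun k : ℕ => p ^ m * Nat.multichoose m k * q ^ k *
        (y ^ (n + m - 1 + k) / (Nat.factorial (n + m - 1 + k) : ℝ)))
      (∑ i ∈ range n, (-1) ^ m * Nat.multichoose m i * p ^ m * q⁻¹ ^ (m + i) *
          (y ^ (n - 1 - i) / (Nat.factorial (n - 1 - i) : ℝ)) +
        ∑ i ∈ range m, (-1) ^ i * Nat.multichoose n i * p ^ i * q⁻¹ ^ (n + i) *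
          (Real.exp (q * y) * p * ((p * y) ^ (m - 1 - i) /
            (Nat.factorial (m - 1 - i) : ℝ)))) := by
  induction n generalizing m with
  | zero =>
    obtain ⟨m, rfl⟩ := Nat.exists_eq_succ_of_ne_zero (show m ≠ 0 by omega)
    have h := (hasSum_exp_mul_pow_div_factorial q y m).mul_left (p ^ (m + 1))
    rw [range_zero, sum_empty, zero_add, sum_range_succ']
    simp only [Nat.succ_eq_add_one, Nat.multichoose_zero_succ, zero_add]
    refine hasSum_of_eq h (fun k => ?_) ?_
    · rw [Nat.add_sub_cancel]
      ring
    · simp [mul_pow]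
      ring
  | succ n ihn =>
    induction m with
    | zero =>
      rw [range_zero, sum_empty, add_zero]
      refine hasSum_of_eq (hasSum_single (f := fun k : ℕ => p ^ 0 * (Nat.multichoose 0 k : ℝ) * q ^ k *
        (y ^ (n + 1 + 0 - 1 + k) / (Nat.factorial (n + 1 + 0 - 1 + k) : ℝ))) 0 ?_)
        (fun _ => rfl) ?_
      · intro k hk
        obtain ⟨k, rfl⟩ := Nat.exists_eq_succ_of_ne_zero hk
        simp [Nat.multichoose_zero_succ]
      · rw [sum_range_succ']
        simp [Nat.multichoose_zero_succ]
    | succ m ihm =>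
      have hs := ihn (m + 1) (by omega)
      have ht := ihm (by omega)
      rw [show n + (m + 1) - 1 = n + m by omega] at hs
      rw [show n + 1 + m - 1 = n + m by omega] at ht
      have h := hasSum_multichoose_contiguous hq n m hs ht
      rw [show n + 1 + (m + 1) - 1 = n + m + 1 by omega]
      refine hasSum_of_eq h (fun _ => rfl) ?_
      have h1 := sum_multichoose_first_pole p q n m
        (fun l => y ^ l / (Nat.factorial l : ℝ))
      have h2 := sum_multichoose_second_pole p q n m
        (fun l => Real.exp (q * y) * p * ((p * y) ^ l / (Nat.factorial l : ℝ)))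
      simp only [Nat.add_sub_cancel] at h1 h2 ⊢
      rw [h1, h2]
      ring

lemma risingFactorial_natCast (n k : ℕ) :
    risingFactorial n k = (Nat.ascFactorial n k : ℝ) := by
  rw [risingFactorial, Nat.ascFactorial_eq_prod_range]
  push_cast
  rfl

lemma risingFactorial_succ_eq_multichoose (m k : ℕ) :
    risingFactorial (m + 1 : ℕ) k = (Nat.factorial k : ℝ) * Nat.multichoose (m + 1) k := by
  rw [risingFactorial_natCast, Nat.ascFactorial_eq_factorial_mul_choose, Nat.multichoose_eq,
    show m + 1 + k - 1 = m + k by omega]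
  push_cast
  rfl

lemma hyp1F1_mul_pow_div_factorial (m N : ℕ) (q y : ℝ) :
    hyp1F1 (m + 1 : ℕ) (N + 1 : ℕ) (q * y) * (y ^ N / (Nat.factorial N : ℝ)) =
      ∑' k : ℕ, (Nat.multichoose (m + 1) k : ℝ) * q ^ k *
        (y ^ (N + k) / (Nat.factorial (N + k) : ℝ)) := by
  rw [hyp1F1, ← tsum_mul_right]
  refine tsum_congr fun k => ?_
  rw [risingFactorial_succ_eq_multichoose, risingFactorial_natCast,
    ← Nat.factorial_mul_ascFactorial N k]
  have h0 : (Nat.factorial k : ℝ) ≠ 0 := by positivity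
  have h1 : (Nat.factorial N : ℝ) ≠ 0 := by positivity
  have h2 : ((N + 1).ascFactorial k : ℝ) ≠ 0 := by
    exact_mod_cast (Nat.ascFactorial_pos N k).ne'
  push_cast
  field_simp
  ring

/-! ### Logarithmic moments of Erlang densities -/

lemma integrableOn_pow_mul_exp_neg_mul {a : ℝ} (ha : 0 < a) (k : ℕ) :
    IntegrableOn (fun x : ℝ => x ^ k * Real.exp (-(a * x))) (Set.Ioi 0) := by
  have h := integrableOn_rpow_mul_exp_neg_mul_rpow (p := 1) (s := k) (b := a)
    (by have : (0 : ℝ) ≤ k := Nat.cast_nonneg k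
        linarith) one_pos ha
  simpa [Real.rpow_natCast] using h

lemma integrableOn_log_mul_pow_mul_exp {a : ℝ} (ha : 0 < a) (k : ℕ) :
    IntegrableOn (fun x : ℝ => Real.log (1 + x) * (x ^ k * Real.exp (-(a * x))))
      (Set.Ioi 0) := by
  refine (integrableOn_pow_mul_exp_neg_mul ha (k + 1)).mono' ?_ ?_
  · exact Measurable.aestronglyMeasurable (by fun_prop)
  · refine (ae_restrict_iff' measurableSet_Ioi).2 (Filter.Eventually.of_forall fun x hx => ?_)
    have hx : 0 < x := hx
    have h1 := Real.log_le_sub_one_of_pos (show 0 < 1 + x by linarith)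
    have h0 := Real.log_nonneg (show 1 ≤ 1 + x by linarith)
    rw [norm_mul, Real.norm_of_nonneg h0, Real.norm_of_nonneg (by positivity), pow_succ' x k,
      mul_assoc]
    gcongr
    linarith

lemma integrableOn_pow_mul_exp_div {a : ℝ} (ha : 0 < a) (k : ℕ) :
    IntegrableOn (fun x : ℝ => x ^ k * Real.exp (-(a * x)) / (1 + x)) (Set.Ioi 0) := by
  refine (integrableOn_pow_mul_exp_neg_mul ha k).mono' ?_ ?_
  · exact Measurable.aestronglyMeasurable (by fun_prop)
  · refine (ae_restrict_iff' measurableSet_Ioi).2 (Filter.Eventually.of_forall fun x hx => ?_)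
    have hx : 0 < x := hx
    rw [Real.norm_of_nonneg (by positivity)]
    exact div_le_self (by positivity) (by linarith)

lemma integral_pow_mul_exp_neg_mul {a : ℝ} (ha : 0 < a) (k : ℕ) :
    ∫ x in Set.Ioi (0 : ℝ), x ^ k * Real.exp (-(a * x)) =
      (Nat.factorial k : ℝ) / a ^ (k + 1) := by
  have h := Real.integral_rpow_mul_exp_neg_mul_Ioi (a := k + 1) (r := a) (by positivity) ha
  rw [Real.Gamma_nat_eq_factorial] at h
  simp only [add_sub_cancel_right, Real.rpow_natCast] at h
  rw [h, show ((k : ℝ) + 1) = ((k + 1 : ℕ) : ℝ) by push_cast; rfl, Real.rpow_natCast, one_div, inv_pow]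
  ring

lemma upperGammaNegInt_eq (k : ℕ) (z : ℝ) :
    upperGammaNegInt k z = ∫ t in Set.Ioi z, (t ^ (k + 1))⁻¹ * Real.exp (-t) := by
  rw [upperGammaNegInt]
  congr! 3 with t
  rw [show (-(k : ℤ) - 1) = -((k + 1 : ℕ) : ℤ) by push_cast; ring, zpow_neg, zpow_natCast]

lemma integrableOn_inv_pow_mul_exp_neg {z : ℝ} (hz : 0 < z) (k : ℕ) :
    IntegrableOn (fun t : ℝ => (t ^ k)⁻¹ * Real.exp (-t)) (Set.Ioi z) := by
  refine ((integrableOn_exp_neg_Ioi z).const_mul (z ^ k)⁻¹).mono' ?_ ?_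
  · exact Measurable.aestronglyMeasurable (by fun_prop)
  · refine (ae_restrict_iff' measurableSet_Ioi).2 (Filter.Eventually.of_forall fun t ht => ?_)
    have ht : z < t := ht
    have ht0 : 0 < t := hz.trans ht
    rw [Real.norm_of_nonneg (by positivity)]
    gcongr

lemma tendsto_inv_pow_mul_exp_neg (k : ℕ) :
    Filter.Tendsto (fun t : ℝ => (t ^ (k + 1))⁻¹ * Real.exp (-t)) Filter.atTop (nhds 0) := by
  have h1 : Filter.Tendsto (fun t : ℝ => (t ^ (k + 1))⁻¹) Filter.atTop (nhds 0) :=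
    (Filter.tendsto_pow_atTop (Nat.succ_ne_zero k)).inv_tendsto_atTop
  simpa using h1.mul Real.tendsto_exp_neg_atTop_nhds_zero

/-- Recurrence for the incomplete gamma function at negative integers. -/
lemma upperGammaNegInt_succ {z : ℝ} (hz : 0 < z) (k : ℕ) :
    (k + 1) * upperGammaNegInt (k + 1) z =
      (z ^ (k + 1))⁻¹ * Real.exp (-z) - upperGammaNegInt k z := by
  have hd : ∀ t ∈ Set.Ici z, HasDerivAt (fun t : ℝ => (t ^ (k + 1))⁻¹ * Real.exp (-t))
      (-((k + 1) * ((t ^ (k + 2))⁻¹ * Real.exp (-t))) - (t ^ (k + 1))⁻¹ * Real.exp (-t)) t := by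
    intro t ht
    have ht0 : t ≠ 0 := (hz.trans_le ht).ne'
    have h1 := ((hasDerivAt_pow (k + 1) t).inv (pow_ne_zero _ ht0)).mul (hasDerivAt_neg t).exp
    refine h1.congr_deriv ?_
    push_cast
    simp only [Pi.inv_apply]
    field_simp
    ring
  have hi : IntegrableOn (fun t : ℝ => -((k + 1) * ((t ^ (k + 2))⁻¹ * Real.exp (-t))))
      (Set.Ioi z) := ((integrableOn_inv_pow_mul_exp_neg hz (k + 2)).const_mul ((k : ℝ) + 1)).neg
  have hi' := integrableOn_inv_pow_mul_exp_neg hz (k + 1)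
  have h := integral_Ioi_of_hasDerivAt_of_tendsto' hd (hi.sub hi') (tendsto_inv_pow_mul_exp_neg k)
  rw [integral_sub hi hi', integral_neg, integral_const_mul] at h
  rw [upperGammaNegInt_eq, upperGammaNegInt_eq]
  linarith

lemma integral_exp_div_one_add {a : ℝ} (ha : 0 < a) :
    ∫ x in Set.Ioi (0 : ℝ), Real.exp (-(a * x)) / (1 + x) =
      Real.exp a * upperGammaNegInt 0 a := by
  have h := integral_comp_mul_left_Ioi (fun t : ℝ => (t ^ (0 + 1))⁻¹ * Real.exp (-t)) 1 ha
  rw [mul_one, ← upperGammaNegInt_eq, smul_eq_mul, eq_inv_mul_iff_mul_eq₀ ha.ne'] at h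
  have hs := (measurePreserving_add_right volume (1 : ℝ)).setIntegral_preimage_emb
    (measurableEmbedding_addRight 1)
    (fun x : ℝ => ((a * x) ^ (0 + 1))⁻¹ * Real.exp (-(a * x))) (Set.Ioi 1)
  rw [← h, ← hs, Set.preimage_add_const_Ioi, sub_self, ← integral_const_mul, ← integral_const_mul]
  refine setIntegral_congr_fun measurableSet_Ioi fun x hx => ?_
  have hx : 0 < x := hx
  have h1 : 1 + x ≠ 0 := by positivity
  have h2 : Real.exp (-(a * (x + 1))) = Real.exp (-(a * x)) * (Real.exp a)⁻¹ := by
    rw [← Real.exp_neg, ← Real.exp_add]; ring_nf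
  simp only [zero_add, pow_one]
  rw [h2, add_comm x 1]
  have := (Real.exp_pos a).ne'
  field_simp

lemma integral_pow_mul_exp_div_one_add {a : ℝ} (ha : 0 < a) (k : ℕ) :
    ∫ x in Set.Ioi (0 : ℝ), x ^ k * Real.exp (-(a * x)) / (1 + x) =
      (Nat.factorial k : ℝ) * Real.exp a * upperGammaNegInt k a := by
  induction k with
  | zero => simpa using integral_exp_div_one_add ha
  | succ k ih =>
    have h1 : ∫ x in Set.Ioi (0 : ℝ), x ^ (k + 1) * Real.exp (-(a * x)) / (1 + x) =
        ∫ x in Set.Ioi (0 : ℝ), (x ^ k * Real.exp (-(a * x)) -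
          x ^ k * Real.exp (-(a * x)) / (1 + x)) := by
      refine setIntegral_congr_fun measurableSet_Ioi fun x hx => ?_
      have hx : 0 < x := hx
      have h1 : 1 + x ≠ 0 := by positivity
      field_simp
      ring
    rw [h1, integral_sub (integrableOn_pow_mul_exp_neg_mul ha k)
      (integrableOn_pow_mul_exp_div ha k), ih, integral_pow_mul_exp_neg_mul ha,
      Nat.factorial_succ]
    have h2 := upperGammaNegInt_succ ha k
    push_cast
    calc _ = (Nat.factorial k : ℝ) * Real.exp a *
          ((a ^ (k + 1))⁻¹ * Real.exp (-a) - upperGammaNegInt k a) := by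
          rw [Real.exp_neg]
          have := (Real.exp_pos a).ne'
          field_simp
      _ = _ := by rw [← h2]; ring

/-- The Erlang density of shape `k + 1` and rate `a`. -/
noncomputable def erlangDensity (a : ℝ) (k : ℕ) (x : ℝ) : ℝ :=
  a * ((a * x) ^ k / (Nat.factorial k : ℝ)) * Real.exp (-(a * x))

lemma integrableOn_log_mul_erlangDensity {a : ℝ} (ha : 0 < a) (k : ℕ) :
    IntegrableOn (fun x : ℝ => Real.log (1 + x) * erlangDensity a k x) (Set.Ioi 0) := by
  have h := (integrableOn_log_mul_pow_mul_exp ha k).const_mul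
    (a * (a ^ k / (Nat.factorial k : ℝ)))
  refine IntegrableOn.congr_fun h (fun x _ => ?_) measurableSet_Ioi
  simp only [erlangDensity, mul_pow]
  ring

lemma tendsto_log_mul_pow_mul_exp {a : ℝ} (ha : 0 < a) (k : ℕ) :
    Filter.Tendsto (fun x : ℝ => Real.log (1 + x) * (x ^ k * Real.exp (-(a * x))))
      Filter.atTop (nhds 0) := by
  have h := (Real.tendsto_pow_mul_exp_neg_atTop_nhds_zero (k + 1)).comp
    (Filter.tendsto_id.const_mul_atTop ha)
  have h' := h.const_mul ((a ^ (k + 1))⁻¹)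
  rw [mul_zero] at h'
  refine squeeze_zero' ?_ ?_ h'
  · filter_upwards [Filter.eventually_ge_atTop 0] with x hx
    have := Real.log_nonneg (show 1 ≤ 1 + x by linarith)
    positivity
  · filter_upwards [Filter.eventually_ge_atTop 0] with x hx
    have h1 := Real.log_le_sub_one_of_pos (show 0 < 1 + x by linarith)
    calc _ ≤ x * (x ^ k * Real.exp (-(a * x))) := by gcongr; linarith
      _ = _ := by
        simp only [Function.comp, id, mul_pow]
        field_simp
        ring

lemma hasDerivAt_log_one_add {x : ℝ} (hx : 0 ≤ x) :
    HasDerivAt (fun x : ℝ => Real.log (1 + x)) (1 / (1 + x)) x :=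
  ((hasDerivAt_id x).const_add 1).log (by simp only [id]; positivity)

lemma hasDerivAt_exp_neg_mul (a x : ℝ) :
    HasDerivAt (fun x : ℝ => Real.exp (-(a * x))) (-a * Real.exp (-(a * x))) x := by
  refine ((hasDerivAt_id x).const_mul a).neg.exp.congr_deriv ?_
  simp only [id, Pi.neg_apply]
  ring

lemma integral_log_mul_erlangDensity_zero {a : ℝ} (ha : 0 < a) :
    ∫ x in Set.Ioi (0 : ℝ), Real.log (1 + x) * erlangDensity a 0 x =
      Real.exp a * upperGammaNegInt 0 a := by
  have hd : ∀ x ∈ Set.Ici (0 : ℝ),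
      HasDerivAt (fun x : ℝ => Real.log (1 + x) * (x ^ 0 * Real.exp (-(a * x))))
        (x ^ 0 * Real.exp (-(a * x)) / (1 + x) - Real.log (1 + x) * erlangDensity a 0 x) x := by
    intro x hx
    have hx : 0 ≤ x := hx
    have h1 : 1 + x ≠ 0 := by positivity
    simp only [pow_zero, one_mul]
    refine ((hasDerivAt_log_one_add hx).mul (hasDerivAt_exp_neg_mul a x)).congr_deriv ?_
    simp [erlangDensity]
    field_simp
    ring
  have hi := integrableOn_pow_mul_exp_div ha 0
  have hi' := integrableOn_log_mul_erlangDensity ha 0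
  have h := integral_Ioi_of_hasDerivAt_of_tendsto' hd (hi.sub hi')
    (tendsto_log_mul_pow_mul_exp ha 0)
  rw [integral_sub hi hi', integral_pow_mul_exp_div_one_add ha] at h
  simp at h
  linarith

lemma integral_log_mul_erlangDensity_succ {a : ℝ} (ha : 0 < a) (k : ℕ) :
    ∫ x in Set.Ioi (0 : ℝ), Real.log (1 + x) * erlangDensity a (k + 1) x =
      (∫ x in Set.Ioi (0 : ℝ), Real.log (1 + x) * erlangDensity a k x) +
        Real.exp a * (a ^ (k + 1) * upperGammaNegInt (k + 1) a) := by
  set c : ℝ := a ^ (k + 1) / (Nat.factorial (k + 1) : ℝ) with hc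
  have hd : ∀ x ∈ Set.Ici (0 : ℝ),
      HasDerivAt (fun x : ℝ => c * (Real.log (1 + x) * (x ^ (k + 1) * Real.exp (-(a * x)))))
        (c * (x ^ (k + 1) * Real.exp (-(a * x)) / (1 + x)) +
          (Real.log (1 + x) * erlangDensity a k x -
            Real.log (1 + x) * erlangDensity a (k + 1) x)) x := by
    intro x hx
    have hx : 0 ≤ x := hx
    have h1 : 1 + x ≠ 0 := by positivity
    refine (((hasDerivAt_log_one_add hx).mul
      ((hasDerivAt_pow (k + 1) x).mul (hasDerivAt_exp_neg_mul a x))).const_mul c).congr_deriv ?_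
    simp only [erlangDensity, hc, Nat.factorial_succ, Nat.add_sub_cancel, Pi.mul_apply]
    push_cast
    have : (Nat.factorial k : ℝ) ≠ 0 := by positivity
    field_simp
    ring
  have hi := (integrableOn_pow_mul_exp_div ha (k + 1)).const_mul c
  have hi' := integrableOn_log_mul_erlangDensity ha k
  have hi'' := integrableOn_log_mul_erlangDensity ha (k + 1)
  have hs : IntegrableOn (fun x : ℝ => Real.log (1 + x) * erlangDensity a k x -
      Real.log (1 + x) * erlangDensity a (k + 1) x) (Set.Ioi 0) := hi'.sub hi''
  have h := integral_Ioi_of_hasDerivAt_of_tendsto' hd (hi.add hs)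
    ((tendsto_log_mul_pow_mul_exp ha (k + 1)).const_mul c)
  rw [integral_add hi hs, integral_sub hi' hi'', integral_const_mul,
    integral_pow_mul_exp_div_one_add ha] at h
  have hc' : c * (Nat.factorial (k + 1) : ℝ) = a ^ (k + 1) := by
    rw [hc]; field_simp
  simp only [add_zero, Real.log_one, zero_mul, mul_zero, sub_zero] at h
  rw [← mul_assoc, ← mul_assoc, hc'] at h
  linarith

/-- The expectation of `log (1 + X)` for an Erlang variable `X`. -/
lemma integral_log_mul_erlangDensity {a : ℝ} (ha : 0 < a) (k : ℕ) :
    ∫ x in Set.Ioi (0 : ℝ), Real.log (1 + x) * erlangDensity a k x =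
      Real.exp a * ∑ l ∈ range (k + 1), a ^ l * upperGammaNegInt l a := by
  induction k with
  | zero => simpa using integral_log_mul_erlangDensity_zero ha
  | succ k ih =>
    rw [integral_log_mul_erlangDensity_succ ha, ih, sum_range_succ _ (k + 1), mul_add]

/-! ### The κ-μ shadowed density as a mixture of Erlang densities -/

lemma kmuShadowedPDF_eq_sum_erlangDensity {γ κ : ℝ} (hγ : 0 < γ) (hκ : 0 < κ) {n m : ℕ}
    (hm : 0 < m) {a p q : ℝ} (ha : a = ((n + m : ℕ) : ℝ) * (1 + κ) / γ)
    (hp : p = (m : ℝ) / ((n + m : ℕ) * κ + m))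
    (hq : q = ((n + m : ℕ) : ℝ) * κ / ((n + m : ℕ) * κ + m)) (x : ℝ) :
    kmuShadowedPDF γ κ (n + m) m x =
      ∑ i ∈ range n, (-1) ^ m * Nat.multichoose m i * p ^ m * q⁻¹ ^ (m + i) *
          erlangDensity a (n - 1 - i) x +
        ∑ i ∈ range m, (-1) ^ i * Nat.multichoose n i * p ^ i * q⁻¹ ^ (n + i) *
          erlangDensity (a * p) (m - 1 - i) x := by
  have hμ : (0 : ℝ) < (n + m : ℕ) := by exact_mod_cast (by omega : 0 < n + m)
  have hm' : (0 : ℝ) < m := by exact_mod_cast hm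
  have hd : 0 < ((n + m : ℕ) : ℝ) * κ + m := by positivity
  have hq0 : q ≠ 0 := by rw [hq]; positivity
  have hpq : p = 1 - q := by rw [hp, hq]; field_simp; ring
  have hS := (hasSum_partial_fractions (p := p) hq0 (a * x) n m (by omega)).tsum_eq
  have hexp : ∀ j, erlangDensity (a * p) j x = a * Real.exp (-(a * x)) *
      (Real.exp (q * (a * x)) * p * ((p * (a * x)) ^ j / (Nat.factorial j : ℝ))) := by
    intro j
    have : Real.exp (-(a * p * x)) = Real.exp (-(a * x)) * Real.exp (q * (a * x)) := by
      rw [← Real.exp_add, hpq]; ring_nf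
    rw [erlangDensity, this, show a * p * x = p * (a * x) by ring]
    ring
  have hR : ∑ i ∈ range n, (-1) ^ m * Nat.multichoose m i * p ^ m * q⁻¹ ^ (m + i) *
          erlangDensity a (n - 1 - i) x +
        ∑ i ∈ range m, (-1) ^ i * Nat.multichoose n i * p ^ i * q⁻¹ ^ (n + i) *
          erlangDensity (a * p) (m - 1 - i) x =
      a * Real.exp (-(a * x)) * ∑' k : ℕ, p ^ m * Nat.multichoose m k * q ^ k *
        ((a * x) ^ (n + m - 1 + k) / (Nat.factorial (n + m - 1 + k) : ℝ)) := by
    rw [hS, mul_add, mul_sum, mul_sum]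
    congr 1
    · refine sum_congr rfl fun i _ => ?_
      rw [erlangDensity]
      ring
    · refine sum_congr rfl fun i _ => ?_
      rw [hexp]
      ring
  rw [hR]
  simp only [mul_assoc (p ^ m)]
  rw [tsum_mul_left]
  obtain ⟨m, rfl⟩ := Nat.exists_eq_succ_of_ne_zero hm.ne'
  have hH := hyp1F1_mul_pow_div_factorial m (n + m) q (a * x)
  rw [show n + (m + 1) - 1 = n + m by omega, Nat.succ_eq_add_one, ← hH, kmuShadowedPDF,
    show n + (m + 1) - 1 = n + m by omega]
  have hz : (((n + (m + 1) : ℕ) : ℝ) ^ 2 * κ * (1 + κ) * x /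
      ((((n + (m + 1) : ℕ) : ℝ) * κ + (m + 1 : ℕ)) * γ)) = q * (a * x) := by
    rw [hq, ha, Nat.succ_eq_add_one]
    field_simp
  have he : ((n + (m + 1) : ℕ) : ℝ) * (1 + κ) * x / γ = a * x := by
    rw [ha]; ring
  rw [hz, he, hp, show n + (m + 1) = n + m + 1 by ring]
  generalize hyp1F1 _ _ _ = H
  generalize Real.exp _ = E
  rw [ha]
  simp only [Nat.succ_eq_add_one, show n + (m + 1) = n + m + 1 by ring, mul_pow, div_pow]
  have hd' : ((n + m + 1 : ℕ) : ℝ) * κ + (m + 1 : ℕ) ≠ 0 := hd.ne'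
  rw [add_comm ((m + 1 : ℕ) : ℝ)]
  generalize ((n + m + 1 : ℕ) : ℝ) * κ + (m + 1 : ℕ) = d at *
  field_simp
  ring

lemma integral_logb_mul_kmuShadowedPDF {γ κ : ℝ} (hγ : 0 < γ) (hκ : 0 < κ) {n m : ℕ}
    (hm : 0 < m) {a p q : ℝ} (ha : a = ((n + m : ℕ) : ℝ) * (1 + κ) / γ)
    (hp : p = (m : ℝ) / ((n + m : ℕ) * κ + m))
    (hq : q = ((n + m : ℕ) : ℝ) * κ / ((n + m : ℕ) * κ + m)) :
    ∫ x in Set.Ioi (0 : ℝ), Real.logb 2 (1 + x) * kmuShadowedPDF γ κ (n + m) m x =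
      Real.logb 2 (Real.exp 1) *
        (∑ i ∈ range n, (-1) ^ m * Nat.multichoose m i * p ^ m * q⁻¹ ^ (m + i) *
          (Real.exp a * ∑ l ∈ range (n - 1 - i + 1), a ^ l * upperGammaNegInt l a) +
        ∑ i ∈ range m, (-1) ^ i * Nat.multichoose n i * p ^ i * q⁻¹ ^ (n + i) *
          (Real.exp (a * p) *
            ∑ l ∈ range (m - 1 - i + 1), (a * p) ^ l * upperGammaNegInt l (a * p))) := by
  have hμ : (0 : ℝ) < (n + m : ℕ) := by exact_mod_cast (by omega : 0 < n + m)
  have hm' : (0 : ℝ) < m := by exact_mod_cast hm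
  have ha0 : 0 < a := by rw [ha]; positivity
  have hb0 : 0 < a * p := by rw [hp]; positivity
  have h1 : ∀ i ∈ range n, IntegrableOn (fun x : ℝ =>
      (-1) ^ m * Nat.multichoose m i * p ^ m * q⁻¹ ^ (m + i) *
        (Real.log (1 + x) * erlangDensity a (n - 1 - i) x)) (Set.Ioi 0) :=
    fun i _ => (integrableOn_log_mul_erlangDensity ha0 _).const_mul _
  have h2 : ∀ i ∈ range m, IntegrableOn (fun x : ℝ =>
      (-1) ^ i * Nat.multichoose n i * p ^ i * q⁻¹ ^ (n + i) *
        (Real.log (1 + x) * erlangDensity (a * p) (m - 1 - i) x)) (Set.Ioi 0) :=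
    fun i _ => (integrableOn_log_mul_erlangDensity hb0 _).const_mul _
  simp only [← integral_log_mul_erlangDensity ha0, ← integral_log_mul_erlangDensity hb0,
    ← integral_const_mul]
  rw [← integral_finsetSum _ h1, ← integral_finsetSum _ h2,
    ← integral_add (integrable_finsetSum _ h1) (integrable_finsetSum _ h2), ← integral_const_mul]
  refine setIntegral_congr_fun measurableSet_Ioi fun x _ => ?_
  rw [kmuShadowedPDF_eq_sum_erlangDensity hγ hκ hm ha hp hq x, Real.logb, Real.logb,
    Real.log_exp, div_mul_eq_mul_div, div_mul_eq_mul_div, one_mul, mul_add, mul_sum, mul_sum]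
  congr 2 <;> exact sum_congr rfl fun i _ => by ring

theorem kmuShadowed_capacity_of_lt (γ κ : ℝ) (hγ : 0 < γ) (hκ : 0 < κ)
    (μ m : ℕ) (hμ : 0 < μ) (hm : 0 < m) (hmμ : m < μ) (Δ₁ Δ₂ : ℝ)
    (hΔ₁ : Δ₁ = γ / (μ * (1 + κ)))
    (hΔ₂ : Δ₂ = ((μ * κ + m) / m) * (γ / (μ * (1 + κ))))
    (A₁ A₂ : ℕ → ℝ)
    (hA₁ : ∀ j, A₁ j = (-1 : ℝ) ^ m * (Nat.choose (m + j - 2) (j - 1) : ℝ) *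
      ((m : ℝ) / (μ * κ + m)) ^ m *
      ((μ : ℝ) * κ / (μ * κ + m)) ^ (-((m : ℤ) + j - 1)))
    (hA₂ : ∀ j, A₂ j = (-1 : ℝ) ^ (j - 1) * (Nat.choose (μ - m + j - 2) (j - 1) : ℝ) *
      ((m : ℝ) / (μ * κ + m)) ^ (j - 1) *
      ((μ : ℝ) * κ / (μ * κ + m)) ^ ((m : ℤ) - μ - j + 1)) :
    ∫ x in Set.Ioi (0 : ℝ), Real.logb 2 (1 + x) * kmuShadowedPDF γ κ μ m x =
      Real.logb 2 (Real.exp 1) *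
        ((∑ j ∈ Finset.Icc 1 (μ - m),
            A₁ j * Real.exp (1 / Δ₁) *
              ∑ k ∈ Finset.range (μ - m - j + 1), Δ₁ ^ (-(k : ℤ)) * upperGammaNegInt k (1 / Δ₁)) +
         (∑ j ∈ Finset.Icc 1 m,
            A₂ j * Real.exp (1 / Δ₂) *
              ∑ k ∈ Finset.range (m - j + 1), Δ₂ ^ (-(k : ℤ)) * upperGammaNegInt k (1 / Δ₂))) := by
  obtain ⟨n, rfl⟩ : ∃ n, μ = n + m := ⟨μ - m, by omega⟩
  have hμ' : (0 : ℝ) < (n + m : ℕ) := by exact_mod_cast hμ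
  have hm' : (0 : ℝ) < m := by exact_mod_cast hm
  set p : ℝ := (m : ℝ) / ((n + m : ℕ) * κ + m) with hp
  set q : ℝ := ((n + m : ℕ) : ℝ) * κ / ((n + m : ℕ) * κ + m) with hq
  have h1 : 1 / Δ₁ = ((n + m : ℕ) : ℝ) * (1 + κ) / γ := by rw [hΔ₁, one_div_div]
  have h2 : 1 / Δ₂ = 1 / Δ₁ * p := by rw [hΔ₂, hΔ₁, hp]; field_simp
  have hz : ∀ (Δ : ℝ) (k : ℕ), Δ ^ (-(k : ℤ)) = (1 / Δ) ^ k := fun Δ k => by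
    rw [zpow_neg, zpow_natCast, one_div, inv_pow]
  rw [integral_logb_mul_kmuShadowedPDF hγ hκ hm h1 hp hq]
  simp only [hz, h2, Nat.add_sub_cancel]
  rw [← Finset.Ico_add_one_right_eq_Icc, ← Finset.Ico_add_one_right_eq_Icc,
    sum_Ico_eq_sum_range, sum_Ico_eq_sum_range, Nat.add_sub_cancel, Nat.add_sub_cancel]
  congr 2
  · refine sum_congr rfl fun i _ => ?_
    rw [hA₁, Nat.multichoose_eq, show m + (1 + i) - 2 = m + i - 1 by omega,
      Nat.add_sub_cancel_left, show n - (1 + i) = n - 1 - i by omega,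
      show -((m : ℤ) + (1 + i : ℕ) - 1) = -((m + i : ℕ) : ℤ) by push_cast; ring, hz, one_div]
    ring
  · refine sum_congr rfl fun i _ => ?_
    rw [hA₂, Nat.multichoose_eq, Nat.add_sub_cancel, show n + (1 + i) - 2 = n + i - 1 by omega,
      Nat.add_sub_cancel_left, show m - (1 + i) = m - 1 - i by omega,
      show (m : ℤ) - (n + m : ℕ) - (1 + i : ℕ) + 1 = -((n + i : ℕ) : ℤ) by push_cast; ring, hz,
      one_div]
    ring
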